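/- Let f(w_1,…,w_L) = Σ_{l,k=1}^L c_{lk} g(w_l^T Σ_{lk} w_k) be the RGCCA objective and ∇_l f(w) its partial gradient with respect to w_l. If a vector w̃_l ∈ ℝ^{p_l} satisfies ∇_l f(w)^T w̃_l ≥ ∇_l f(w)^T w_l, then replacing w_l by w̃_l does not decrease the objective: f(w_1,…,w_{l−1}, w̃_l, w_{l+1},…,w_L) ≥ f(w_1,…,w_L). -/

import Mathlib

open Matrix
open scoped RealInnerProductSpace

/-- The quadratic form of a positive semidefinite matrix is convex. -/
theorem Matrix.PosSemidef.convexOn_dotProduct_mulVec {n : Type*} [Fintype n] {A : Matrix n n ℝ}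
    (hA : A.PosSemidef) : ConvexOn ℝ Set.univ fun v : n → ℝ => v ⬝ᵥ (A *ᵥ v) := by
  refine ⟨convex_univ, fun x _ y _ a b ha hb hab => ?_⟩
  have h : 0 ≤ (x - y) ⬝ᵥ (A *ᵥ (x - y)) := by
    simpa using hA.dotProduct_mulVec_nonneg (x - y)
  obtain rfl : b = 1 - a := by linarith
  have h' := mul_nonneg (mul_nonneg ha hb) h
  simp only [mulVec_sub, mulVec_add, mulVec_smul, dotProduct_sub, sub_dotProduct, dotProduct_add,
    add_dotProduct, dotProduct_smul, smul_dotProduct, smul_eq_mul] at h' ⊢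
  linarith

/-- A convex function that is monotone on `[0, ∞)` composed with a nonnegative convex function
is convex. -/
theorem ConvexOn.comp_of_nonneg {E : Type*} [AddCommGroup E] [Module ℝ E] {g : ℝ → ℝ} {q : E → ℝ}
    (hg : ConvexOn ℝ Set.univ g) (hmono : MonotoneOn g (Set.Ici 0))
    (hq : ConvexOn ℝ Set.univ q) (hq0 : ∀ v, 0 ≤ q v) :
    ConvexOn ℝ Set.univ fun v => g (q v) := by
  refine ⟨convex_univ, fun x _ y _ a b ha hb hab => ?_⟩
  have h := hq.2 (Set.mem_univ x) (Set.mem_univ y) ha hb hab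
  exact (hmono (hq0 _) ((hq0 _).trans h) h).trans
    (hg.2 (Set.mem_univ _) (Set.mem_univ _) ha hb hab)

/-- A finite sum of convex functions is convex. -/
theorem ConvexOn.finset_sum {ι E : Type*} [AddCommGroup E] [Module ℝ E] {s : Set E}
    {t : Finset ι} {f : ι → E → ℝ} (hs : Convex ℝ s) (hf : ∀ i ∈ t, ConvexOn ℝ s (f i)) :
    ConvexOn ℝ s fun x => ∑ i ∈ t, f i x := by
  refine ⟨hs, fun x hx y hy a b ha hb hab => ?_⟩
  simp only [Finset.smul_sum, ← Finset.sum_add_distrib]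
  exact Finset.sum_le_sum fun i hi => (hf i hi).2 hx hy ha hb hab

/-- The gradient inequality for a convex function on a real inner product space. -/
theorem ConvexOn.add_inner_gradient_le {E : Type*} [NormedAddCommGroup E] [InnerProductSpace ℝ E]
    [CompleteSpace E] {F : E → ℝ} (hF : ConvexOn ℝ Set.univ F) {x G : E}
    (hG : HasGradientAt F G x) (y : E) : F x + ⟪G, y - x⟫ ≤ F y := by
  have hconv : ConvexOn ℝ Set.univ (F ∘ AffineMap.lineMap (k := ℝ) x y) := by
    simpa using hF.comp_affineMap (AffineMap.lineMap (k := ℝ) x y)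
  have hderiv : HasDerivAt (F ∘ AffineMap.lineMap (k := ℝ) x y) ⟪G, y - x⟫ 0 := by
    have h : HasFDerivAt F (InnerProductSpace.toDual ℝ E G)
        (AffineMap.lineMap (k := ℝ) x y 0) := by
      simpa using hG.hasFDerivAt
    simpa using h.comp_hasDerivAt (0 : ℝ) AffineMap.hasDerivAt_lineMap
  have h := hconv.le_slope_of_hasDerivAt (Set.mem_univ 0) (Set.mem_univ 1) zero_lt_one hderiv
  simp [slope_def_field] at h
  linarith

/-- If `∇_l f(w)ᵀ w̃_l ≥ ∇_l f(w)ᵀ w_l`, then replacing `w_l` by `w̃_l` does not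
decrease the RGCCA objective. -/
theorem rgcca_update_does_not_decrease_objective {L : ℕ} (p : Fin L → ℕ)
    (c : Fin L → Fin L → ℝ)
    (hc_nonneg : ∀ l k, 0 ≤ c l k) (hc_symm : ∀ l k, c l k = c k l)
    (S : ∀ l k, Matrix (Fin (p l)) (Fin (p k)) ℝ)
    (hS_symm : ∀ l k, S k l = (S l k)ᵀ)
    (hS_psd : ∀ l, (S l l).PosSemidef)
    (g : ℝ → ℝ) (hg_conv : ConvexOn ℝ Set.univ g)
    (hg_diff : Differentiable ℝ g)
    (hg' : ∀ x : ℝ, 0 ≤ x → 0 ≤ deriv g x)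
    (w : ∀ k, EuclideanSpace ℝ (Fin (p k))) (l : Fin L)
    (G : EuclideanSpace ℝ (Fin (p l)))
    (hG : HasGradientAt (fun v : EuclideanSpace ℝ (Fin (p l)) =>
        ∑ i, ∑ k, c i k *
          g (Function.update w l v i ⬝ᵥ (S i k *ᵥ Function.update w l v k)))
      G (w l))
    (wt : EuclideanSpace ℝ (Fin (p l)))
    (hwt : ⟪G, wt⟫ ≥ ⟪G, w l⟫) :
    (∑ i, ∑ k, c i k *
        g (Function.update w l wt i ⬝ᵥ (S i k *ᵥ Function.update w l wt k)))
      ≥ ∑ i, ∑ k, c i k * g (w i ⬝ᵥ (S i k *ᵥ w k)) := by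
  have hmono : MonotoneOn g (Set.Ici 0) := by
    refine monotoneOn_of_deriv_nonneg (convex_Ici 0) hg_diff.continuous.continuousOn
      hg_diff.differentiableOn fun x hx => hg' x ?_
    rw [interior_Ici] at hx
    exact le_of_lt hx
  have hconv : ConvexOn ℝ Set.univ (fun v : EuclideanSpace ℝ (Fin (p l)) =>
      ∑ i, ∑ k, c i k *
        g (Function.update w l v i ⬝ᵥ (S i k *ᵥ Function.update w l v k))) := by
    refine ConvexOn.finset_sum convex_univ fun i _ => ConvexOn.finset_sum convex_univ fun k _ => ?_
    refine ConvexOn.smul (hc_nonneg i k) ?_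
    rcases eq_or_ne i l with rfl | hi
    · rcases eq_or_ne k i with rfl | hk
      · simp only [Function.update_self]
        exact hg_conv.comp_of_nonneg hmono
          ((hS_psd k).convexOn_dotProduct_mulVec.comp_linearMap
            (WithLp.linearEquiv 2 ℝ (Fin (p k) → ℝ)).toLinearMap)
          fun v => by simpa using (hS_psd k).dotProduct_mulVec_nonneg v.ofLp
      · simp only [Function.update_self, Function.update_of_ne hk]
        refine ⟨convex_univ, fun x _ y _ a b ha hb hab => ?_⟩
        simpa [add_dotProduct, smul_dotProduct] using
          hg_conv.2 (Set.mem_univ (x ⬝ᵥ (S i k *ᵥ w k))) (Set.mem_univ (y ⬝ᵥ (S i k *ᵥ w k)))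
            ha hb hab
    · rcases eq_or_ne k l with rfl | hk
      · simp only [Function.update_self, Function.update_of_ne hi]
        refine ⟨convex_univ, fun x _ y _ a b ha hb hab => ?_⟩
        simpa [mulVec_add, mulVec_smul, dotProduct_add, dotProduct_smul] using
          hg_conv.2 (Set.mem_univ (w i ⬝ᵥ (S i k *ᵥ x))) (Set.mem_univ (w i ⬝ᵥ (S i k *ᵥ y)))
            ha hb hab
      · simp only [Function.update_of_ne hi, Function.update_of_ne hk]
        exact convexOn_const _ convex_univ
  have h := hconv.add_inner_gradient_le hG wt
  rw [inner_sub_right] at h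
  simp only [Function.update_eq_self] at h
  linarith
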